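/- arXiv:2304.07331 — 2 statements merged into one kernel-verified Lean document; each statement's English description precedes it below -/
import Mathlib

section
/- Let Ω be a symmetric positive definite real 2p×2p matrix written in blocks Ω = [[Ω11, Ω12], [Ω21, Ω22]] with each block p×p, and let G be a real 2p×p matrix written as G = [G1; G2] (G1 stacked above G2) with G1 an invertible p×p matrix. Then Gᵀ Ω⁻¹ G is invertible and (Gᵀ Ω⁻¹ G)⁻¹ ≼ (G1ᵀ Ω11⁻¹ G1)⁻¹, i.e., (G1ᵀ Ω11⁻¹ G1)⁻¹ − (Gᵀ Ω⁻¹ G)⁻¹ is positive semidefinite. -/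
namespace Matrix

variable {m n K : Type*} [Fintype m] [Fintype n] [DecidableEq m] [DecidableEq n]
  [RCLike K]

open scoped ComplexOrder

lemma PosDef.conjTranspose_mul_inv_mul_of_leftInverse {Ω : Matrix m m K} (hΩ : Ω.PosDef)
    {G : Matrix m n K} {L : Matrix n m K} (hL : L * G = 1) : (Gᴴ * Ω⁻¹ * G).PosDef :=
  hΩ.inv.conjTranspose_mul_mul_same fun x y hxy => by
    simpa [mulVec_mulVec, hL] using congrArg (L *ᵥ ·) hxy

/-- **Gauss–Markov theorem**: among the left inverses `L` of `G`, the covariance `L * Ω * Lᴴ` is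
bounded below by `(Gᴴ * Ω⁻¹ * G)⁻¹`. -/
theorem PosDef.posSemidef_mul_mul_conjTranspose_sub_inv {Ω : Matrix m m K} (hΩ : Ω.PosDef)
    {G : Matrix m n K} {L : Matrix n m K} (hL : L * G = 1) :
    (L * Ω * Lᴴ - (Gᴴ * Ω⁻¹ * G)⁻¹).PosSemidef := by
  have hS := hΩ.conjTranspose_mul_inv_mul_of_leftInverse hL
  set S := Gᴴ * Ω⁻¹ * G with hSdef
  have hL' : Gᴴ * Lᴴ = 1 := by rw [← conjTranspose_mul, hL, conjTranspose_one]
  have hΩdet := (isUnit_iff_isUnit_det _).mp hΩ.isUnit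
  have hSdet := (isUnit_iff_isUnit_det _).mp hS.isUnit
  have hΩinv : (Ω⁻¹)ᴴ = Ω⁻¹ := hΩ.inv.isHermitian
  have hSinv : (S⁻¹)ᴴ = S⁻¹ := hS.inv.isHermitian
  set M := S⁻¹ * Gᴴ * Ω⁻¹ with hM
  have hMH : Mᴴ = Ω⁻¹ * G * S⁻¹ := by
    simp [hM, hΩinv, hSinv, Matrix.mul_assoc]
  have hMΩ : M * Ω = S⁻¹ * Gᴴ := by
    rw [hM, Matrix.mul_assoc, nonsing_inv_mul _ hΩdet, Matrix.mul_one]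
  have hΩM : Ω * Mᴴ = G * S⁻¹ := by
    rw [hMH, Matrix.mul_assoc, mul_nonsing_inv_cancel_left _ _ hΩdet]
  have hMΩL : M * Ω * Lᴴ = S⁻¹ := by rw [hMΩ, Matrix.mul_assoc, hL', Matrix.mul_one]
  have hLΩM : L * Ω * Mᴴ = S⁻¹ := by
    rw [Matrix.mul_assoc, hΩM, ← Matrix.mul_assoc, hL, Matrix.one_mul]
  have hMΩM : M * Ω * Mᴴ = S⁻¹ := by
    have : M * G = 1 := by
      rw [hM, Matrix.mul_assoc, Matrix.mul_assoc, ← Matrix.mul_assoc Gᴴ, ← hSdef,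
        nonsing_inv_mul _ hSdet]
    rw [Matrix.mul_assoc, hΩM, ← Matrix.mul_assoc, this, Matrix.one_mul]
  have key : L * Ω * Lᴴ - S⁻¹ = (L - M) * Ω * (L - M)ᴴ := by
    rw [conjTranspose_sub, Matrix.sub_mul, Matrix.sub_mul, Matrix.mul_sub, Matrix.mul_sub,
      hMΩL, hLΩM, hMΩM, sub_self, sub_zero]
  rw [key]
  exact hΩ.posSemidef.mul_mul_conjTranspose_same (L - M)

end Matrix

/-- Efficiency of GALS over OLS: with `Ω = [[Ω11, Ω12], [Ω21, Ω22]]` symmetric positive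
definite and `G = [G1; G2]` with `G1` invertible, `Gᵀ Ω⁻¹ G` is invertible and
`(Gᵀ Ω⁻¹ G)⁻¹ ≼ (G1ᵀ Ω11⁻¹ G1)⁻¹` in the Loewner order. -/
theorem gals_more_efficient_than_ols (p : ℕ)
    (Ω11 Ω12 Ω21 Ω22 G1 G2 : Matrix (Fin p) (Fin p) ℝ)
    (hΩsym : (Matrix.fromBlocks Ω11 Ω12 Ω21 Ω22).IsSymm)
    (hΩ : (Matrix.fromBlocks Ω11 Ω12 Ω21 Ω22).PosDef)
    (hG1 : IsUnit G1) :
    IsUnit ((Matrix.fromRows G1 G2).transpose * (Matrix.fromBlocks Ω11 Ω12 Ω21 Ω22)⁻¹ *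
        Matrix.fromRows G1 G2) ∧
      ((G1.transpose * Ω11⁻¹ * G1)⁻¹ -
        ((Matrix.fromRows G1 G2).transpose * (Matrix.fromBlocks Ω11 Ω12 Ω21 Ω22)⁻¹ *
          Matrix.fromRows G1 G2)⁻¹).PosSemidef := by
  have hG1det := (Matrix.isUnit_iff_isUnit_det _).mp hG1
  let L : Matrix (Fin p) (Fin p ⊕ Fin p) ℝ := Matrix.fromCols G1⁻¹ 0
  have hL : L * Matrix.fromRows G1 G2 = 1 := by
    rw [Matrix.fromCols_mul_fromRows, Matrix.nonsing_inv_mul _ hG1det, Matrix.zero_mul, add_zero]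
  have hΩ11 : Ω11.PosDef := hΩ.submatrix Sum.inl_injective
  have hOLS : (G1.transpose * Ω11⁻¹ * G1)⁻¹ =
      L * Matrix.fromBlocks Ω11 Ω12 Ω21 Ω22 * L.conjTranspose := by
    rw [Matrix.mul_inv_rev, Matrix.mul_inv_rev,
      Matrix.nonsing_inv_nonsing_inv _ ((Matrix.isUnit_iff_isUnit_det _).mp hΩ11.isUnit),
      Matrix.fromCols_mul_fromBlocks, Matrix.conjTranspose_fromCols_eq_fromRows_conjTranspose,
      Matrix.fromCols_mul_fromRows]
    simp [Matrix.conjTranspose_eq_transpose_of_trivial, Matrix.transpose_nonsing_inv,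
      Matrix.mul_assoc]
  rw [hOLS, ← Matrix.conjTranspose_eq_transpose_of_trivial]
  exact ⟨(hΩ.conjTranspose_mul_inv_mul_of_leftInverse hL).isUnit,
    hΩ.posSemidef_mul_mul_conjTranspose_sub_inv hL⟩
end

section
/- Let Ω be a symmetric positive definite real 2p×2p matrix written in blocks Ω = [[Ω11, Ω12], [Ω21, Ω22]] with each block p×p, and let G be a real 2p×p matrix written as G = [G1; G2] (G1 stacked above G2) with G2 an invertible p×p matrix. Then Gᵀ Ω⁻¹ G is invertible and (Gᵀ Ω⁻¹ G)⁻¹ ≼ (G2ᵀ Ω22⁻¹ G2)⁻¹, i.e., (G2ᵀ Ω22⁻¹ G2)⁻¹ − (Gᵀ Ω⁻¹ G)⁻¹ is positive semidefinite. -/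
open Matrix in
/-- Gauss–Markov: every left inverse `L` of `G` satisfies `(Gᵀ Ω⁻¹ G)⁻¹ ≼ L Ω Lᵀ`. -/
theorem gauss_markov_posSemidef {m n : Type*} [Fintype m] [DecidableEq m] [Fintype n]
    [DecidableEq n] {Ω : Matrix m m ℝ} (hΩ : Ω.PosDef) {G : Matrix m n ℝ} {L : Matrix n m ℝ}
    (hLG : L * G = 1) :
    IsUnit (Gᵀ * Ω⁻¹ * G) ∧ (L * Ω * Lᵀ - (Gᵀ * Ω⁻¹ * G)⁻¹).PosSemidef := by
  have hinj : Function.Injective G.mulVec := fun x y hxy => by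
    simpa [hLG] using congrArg L.mulVec hxy
  have hM : (Gᵀ * Ω⁻¹ * G).PosDef := by
    simpa using hΩ.inv.conjTranspose_mul_mul_same hinj
  refine ⟨hM.isUnit, ?_⟩
  have hMdet := (isUnit_iff_isUnit_det _).mp hM.isUnit
  have hΩdet := (isUnit_iff_isUnit_det _).mp hΩ.isUnit
  have hMs : (Gᵀ * Ω⁻¹ * G)⁻¹ᵀ = (Gᵀ * Ω⁻¹ * G)⁻¹ := by simpa using hM.inv.isHermitian.eq
  have hΩs : Ω⁻¹ᵀ = Ω⁻¹ := by simpa using hΩ.inv.isHermitian.eq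
  have hGL : Gᵀ * Lᵀ = 1 := by rw [← transpose_mul, hLG, transpose_one]
  have hMM := nonsing_inv_mul _ hMdet
  generalize hN : (Gᵀ * Ω⁻¹ * G)⁻¹ = N at hMs hMM ⊢
  have key : (L - N * Gᵀ * Ω⁻¹) * Ω * (L - N * Gᵀ * Ω⁻¹)ᵀ = L * Ω * Lᵀ - N := by
    have h₁ : (L - N * Gᵀ * Ω⁻¹) * Ω = L * Ω - N * Gᵀ := by
      rw [Matrix.sub_mul, nonsing_inv_mul_cancel_right _ _ hΩdet]
    have h₂ : (L - N * Gᵀ * Ω⁻¹)ᵀ = Lᵀ - Ω⁻¹ * G * N := by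
      simp only [transpose_sub, transpose_mul, transpose_transpose, hMs, hΩs, Matrix.mul_assoc]
    have h₃ : L * Ω * (Ω⁻¹ * G * N) = N := by
      rw [Matrix.mul_assoc Ω⁻¹, ← Matrix.mul_assoc, mul_nonsing_inv_cancel_right _ _ hΩdet,
        ← Matrix.mul_assoc, hLG, Matrix.one_mul]
    have h₄ : N * Gᵀ * Lᵀ = N := by rw [Matrix.mul_assoc, hGL, Matrix.mul_one]
    have h₅ : N * Gᵀ * (Ω⁻¹ * G * N) = N := by
      calc N * Gᵀ * (Ω⁻¹ * G * N) = N * (Gᵀ * Ω⁻¹ * G) * N := by simp only [Matrix.mul_assoc]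
        _ = N := by rw [hMM, Matrix.one_mul]
    rw [h₁, h₂, Matrix.sub_mul, Matrix.mul_sub, Matrix.mul_sub, h₃, h₄, h₅, sub_self, sub_zero]
  rw [← key]
  simpa using hΩ.posSemidef.mul_mul_conjTranspose_same (L - N * Gᵀ * Ω⁻¹)


/-- Efficiency of GALS over WLS: with `Ω = [[Ω11, Ω12], [Ω21, Ω22]]` symmetric positive
definite and `G = [G1; G2]` with `G2` invertible, `Gᵀ Ω⁻¹ G` is invertible and
`(Gᵀ Ω⁻¹ G)⁻¹ ≼ (G2ᵀ Ω22⁻¹ G2)⁻¹` in the Loewner order. -/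
theorem gals_more_efficient_than_wls (p : ℕ)
    (Ω11 Ω12 Ω21 Ω22 G1 G2 : Matrix (Fin p) (Fin p) ℝ)
    (hΩsym : (Matrix.fromBlocks Ω11 Ω12 Ω21 Ω22).IsSymm)
    (hΩ : (Matrix.fromBlocks Ω11 Ω12 Ω21 Ω22).PosDef)
    (hG2 : IsUnit G2) :
    IsUnit ((Matrix.fromRows G1 G2).transpose * (Matrix.fromBlocks Ω11 Ω12 Ω21 Ω22)⁻¹ *
        Matrix.fromRows G1 G2) ∧
      ((G2.transpose * Ω22⁻¹ * G2)⁻¹ -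
        ((Matrix.fromRows G1 G2).transpose * (Matrix.fromBlocks Ω11 Ω12 Ω21 Ω22)⁻¹ *
          Matrix.fromRows G1 G2)⁻¹).PosSemidef := by
  have hG2det := (Matrix.isUnit_iff_isUnit_det _).mp hG2
  have hΩ22 : Ω22.PosDef := hΩ.submatrix (e := Sum.inr) Sum.inr_injective
  have hLG : Matrix.fromCols (0 : Matrix (Fin p) (Fin p) ℝ) G2⁻¹ * Matrix.fromRows G1 G2 = 1 := by
    rw [Matrix.fromCols_mul_fromRows, Matrix.zero_mul, zero_add, Matrix.nonsing_inv_mul _ hG2det]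
  have hL : (G2.transpose * Ω22⁻¹ * G2)⁻¹ = Matrix.fromCols (0 : Matrix (Fin p) (Fin p) ℝ) G2⁻¹ *
      Matrix.fromBlocks Ω11 Ω12 Ω21 Ω22 *
        (Matrix.fromCols (0 : Matrix (Fin p) (Fin p) ℝ) G2⁻¹).transpose := by
    rw [Matrix.mul_inv_rev, Matrix.mul_inv_rev, Matrix.nonsing_inv_nonsing_inv _
      ((Matrix.isUnit_iff_isUnit_det _).mp hΩ22.isUnit), Matrix.transpose_fromCols,
      Matrix.fromCols_mul_fromBlocks, Matrix.fromCols_mul_fromRows, Matrix.transpose_nonsing_inv]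
    simp [Matrix.mul_assoc]
  rw [hL]
  exact gauss_markov_posSemidef hΩ hLG
end
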